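/- Consider a reversible chain setup with transition matrix P, stationary vector π and Laplacian L, with Moore–Penrose pseudoinverse L†, and let V be an (n−1)×n real matrix with VᵀV = L† and V·1 = 0, with columns v_1, …, v_n ∈ ℝ^{n−1} (the vertices of the associated simplex). Let γ ∈ ℝ^{n−1} and R ≥ 0 satisfy ‖γ − v_x‖ = R for every state x (circumcenter and circumradius), and let ℓ := Σ_x π(x)·v_x (the Lemoine point). For each state y, let h_y ∈ ℝ^n satisfy h_y(y) = 0 and h_y(t) = 1 + Σ_z P(t,z)·h_y(z) for all t ≠ y. Then for every state x, Kemeny's constant K := Σ_y π(y)·h_y(x) satisfies K = R² − ‖γ − ℓ‖². -/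

import Mathlib

open Matrix Finset

/-- A harmonic function of a connected reversible chain is constant. -/
theorem eq_of_harmonic {ι : Type*} [Fintype ι] (P : Matrix ι ι ℝ) (w : ι → ℝ)
    (hP0 : ∀ x y, 0 ≤ P x y) (hProw : ∀ x, ∑ y, P x y = 1) (hw : ∀ x, 0 < w x)
    (hrev : ∀ x y, w x * P x y = w y * P y x)
    (hconn : (SimpleGraph.fromRel (fun x y : ι => 0 < P x y)).Connected)
    (f : ι → ℝ) (hf : ∀ x, f x = ∑ y, P x y * f y) (x y : ι) : f x = f y := by
  have hleft : ∑ x, ∑ y, w x * P x y * f x ^ 2 = ∑ x, w x * f x ^ 2 := by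
    refine sum_congr rfl fun x _ => ?_
    rw [← sum_mul, ← mul_sum, hProw, mul_one]
  have hright : ∑ x, ∑ y, w x * P x y * f y ^ 2 = ∑ x, w x * f x ^ 2 := by
    rw [sum_comm, ← hleft]
    exact sum_congr rfl fun x _ => sum_congr rfl fun y _ => by rw [hrev]
  have hcross : ∑ x, ∑ y, w x * P x y * (f x * f y) = ∑ x, w x * f x ^ 2 := by
    refine sum_congr rfl fun x _ => ?_
    calc ∑ y, w x * P x y * (f x * f y) = w x * f x * ∑ y, P x y * f y := by
          rw [mul_sum]
          exact sum_congr rfl fun y _ => by ring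
      _ = w x * f x ^ 2 := by rw [← hf]; ring
  have henergy : ∑ x, ∑ y, w x * P x y * (f x - f y) ^ 2 = 0 := by
    have hexpand : ∑ x, ∑ y, w x * P x y * (f x - f y) ^ 2 =
        ∑ x, ∑ y, w x * P x y * f x ^ 2 - 2 * ∑ x, ∑ y, w x * P x y * (f x * f y) +
          ∑ x, ∑ y, w x * P x y * f y ^ 2 := by
      simp only [mul_sum, ← sum_sub_distrib, ← sum_add_distrib]
      exact sum_congr rfl fun x _ => sum_congr rfl fun y _ => by ring
    rw [hexpand, hleft, hright, hcross]
    ring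
  have hnonneg : ∀ x y, 0 ≤ w x * P x y * (f x - f y) ^ 2 := fun x y =>
    mul_nonneg (mul_nonneg (hw x).le (hP0 x y)) (sq_nonneg _)
  have hedge : ∀ x y, 0 < P x y → f x = f y := by
    intro x y hxy
    have hrow := (sum_eq_zero_iff_of_nonneg
      fun x _ => sum_nonneg fun y _ => hnonneg x y).1 henergy x (mem_univ x)
    have hterm := (sum_eq_zero_iff_of_nonneg fun y _ => hnonneg x y).1 hrow y (mem_univ y)
    have hsq := (mul_eq_zero.1 hterm).resolve_left (mul_pos (hw x) hxy).ne'
    exact sub_eq_zero.1 (pow_eq_zero_iff two_ne_zero |>.1 hsq)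
  obtain ⟨p⟩ := hconn.preconnected x y
  induction p with
  | nil => rfl
  | cons hadj _ ih =>
    rw [← ih]
    rcases (SimpleGraph.fromRel_adj _ _ _).1 hadj with ⟨-, hadj | hadj⟩
    · exact hedge _ _ hadj
    · exact (hedge _ _ hadj).symm

/-- The Laplacian acts as `f ↦ w (f - P f)`. -/
theorem laplacian_mulVec {ι : Type*} [Fintype ι] [DecidableEq ι] (P L : Matrix ι ι ℝ)
    (w : ι → ℝ) (hPdiag : ∀ x, P x x = 0) (hLdiag : ∀ x, L x x = w x)
    (hLoff : ∀ x y, x ≠ y → L x y = -(w x * P x y)) (f : ι → ℝ) (x : ι) :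
    (L *ᵥ f) x = w x * (f x - ∑ y, P x y * f y) := by
  have hL : ∀ y, L x y * f y = w x * ((if x = y then f y else 0) - P x y * f y) := by
    intro y
    by_cases hxy : x = y
    · subst hxy
      simp [hLdiag, hPdiag]
    · simp [hLoff x y hxy, hxy]
      ring
  simp only [mulVec, dotProduct, hL, ← mul_sum, sum_sub_distrib, sum_ite_eq, mem_univ, if_true]

/-- Weighted average of squared distances from `c` to the points `v x` (parallel axis theorem). -/
theorem sum_mul_norm_sub_sq {ι E : Type*} [Fintype ι] [NormedAddCommGroup E]
    [InnerProductSpace ℝ E] (w : ι → ℝ) (hw : ∑ x, w x = 1) (v : ι → E) (c : E) :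
    ∑ x, w x * ‖c - v x‖ ^ 2 =
      ‖c - ∑ x, w x • v x‖ ^ 2 + (∑ x, w x * ‖v x‖ ^ 2 - ‖∑ x, w x • v x‖ ^ 2) := by
  have hinner : inner ℝ c (∑ x, w x • v x) = ∑ x, w x * inner ℝ c (v x) := by
    simp only [inner_sum, inner_smul_right]
  have hsum : ∑ x, w x * ‖c - v x‖ ^ 2 =
      (∑ x, w x) * ‖c‖ ^ 2 - 2 * ∑ x, w x * inner ℝ c (v x) + ∑ x, w x * ‖v x‖ ^ 2 := by
    rw [sum_mul, mul_sum, ← sum_sub_distrib, ← sum_add_distrib]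
    refine sum_congr rfl fun x _ => ?_
    rw [norm_sub_sq_real]
    ring
  rw [hsum, hw, norm_sub_sq_real, hinner]
  ring

/-- Main Theorem (Theorem 1.1 = Theorem 4.2) in its full Markov-chain form:
Kemeny's constant `K = Σ_y π(y) h_y(x)` equals `R² − ‖γ − ℓ‖²`, where `R` is the
circumradius, `γ` the circumcenter and `ℓ` the Lemoine point of the simplex whose
squared edge lengths are the commute times of the chain. -/
theorem kemeny_constant_main_theorem (n : ℕ) (hn : 2 ≤ n)
    (P L Ld : Matrix (Fin n) (Fin n) ℝ) (pi : Fin n → ℝ)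
    -- reversible chain setup
    (hP0 : ∀ x y, 0 ≤ P x y)
    (hPdiag : ∀ x, P x x = 0)
    (hProw : ∀ x, ∑ y, P x y = 1)
    (hpipos : ∀ x, 0 < pi x)
    (hpisum : ∑ x, pi x = 1)
    (hrev : ∀ x y, pi x * P x y = pi y * P y x)
    (hconn : (SimpleGraph.fromRel (fun x y : Fin n => 0 < P x y)).Connected)
    -- the Laplacian matrix
    (hLdiag : ∀ x, L x x = pi x)
    (hLoff : ∀ x y, x ≠ y → L x y = -(pi x * P x y))
    -- Ld is the Moore–Penrose pseudoinverse of L (the four Penrose conditions)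
    (hp1 : L * Ld * L = L) (hp2 : Ld * L * Ld = Ld)
    (hp3 : (L * Ld)ᵀ = L * Ld) (hp4 : (Ld * L)ᵀ = Ld * L)
    -- the matrix V with VᵀV = L† and V·1 = 0, whose columns are the simplex vertices
    (V : Matrix (Fin (n-1)) (Fin n) ℝ)
    (hV : Vᵀ * V = Ld)
    (hV1 : V.mulVec (fun _ => 1) = 0)
    (v : Fin n → EuclideanSpace ℝ (Fin (n-1)))
    (hv : ∀ c j, v c j = V j c)
    -- circumcenter and circumradius
    (γ : EuclideanSpace ℝ (Fin (n-1))) (R : ℝ) (hR : 0 ≤ R)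
    (hcirc : ∀ x, ‖γ - v x‖ = R)
    -- the Lemoine point
    (ℓ : EuclideanSpace ℝ (Fin (n-1))) (hl : ℓ = ∑ x, pi x • v x)
    -- hitting times to each state y
    (h : Fin n → Fin n → ℝ)
    (hdiag : ∀ y, h y y = 0)
    (hrec : ∀ y t, t ≠ y → h y t = 1 + ∑ z, P t z * h y z) :
    ∀ x : Fin n, ∑ y, pi y * h y x = R^2 - ‖γ - ℓ‖^2 := by
  intro x
  have hL := laplacian_mulVec P L pi hPdiag hLdiag hLoff
  have hker : ∀ f : Fin n → ℝ, L *ᵥ f = 0 → ∀ x y, f x = f y := by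
    intro f hf
    refine eq_of_harmonic P pi hP0 hProw hpipos hrev hconn f fun x => ?_
    have hx := hL f x
    rw [hf, Pi.zero_apply, eq_comm, mul_eq_zero] at hx
    exact sub_eq_zero.1 (hx.resolve_left (hpipos x).ne')
  have hsum : ∀ f : Fin n → ℝ, ∑ t, (L *ᵥ f) t = 0 := by
    intro f
    have hswap : ∑ t, ∑ z, pi t * (P t z * f z) = ∑ t, pi t * f t := by
      rw [sum_comm]
      refine sum_congr rfl fun z _ => ?_
      calc ∑ t, pi t * (P t z * f z) = pi z * f z * ∑ t, P z t := by
            rw [mul_sum]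
            refine sum_congr rfl fun t _ => ?_
            rw [← mul_assoc, hrev]
            ring
        _ = pi z * f z := by rw [hProw, mul_one]
    simp only [hL, mul_sub, sum_sub_distrib, mul_sum, hswap, sub_self]
  have hLh : ∀ y, L *ᵥ h y = pi - Pi.single y 1 := by
    intro y
    have hoff : ∀ t, t ≠ y → (L *ᵥ h y) t = pi t := by
      intro t ht
      rw [hL, hrec y t ht, add_sub_cancel_right, mul_one]
    funext t
    by_cases ht : t = y
    · subst ht
      have h1 := hsum (h t)
      rw [← add_sum_erase _ _ (mem_univ t),
        sum_congr rfl fun s hs => hoff s (ne_of_mem_erase hs)] at h1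
      have h2 := add_sum_erase univ pi (mem_univ t)
      simp only [Pi.sub_apply, Pi.single_eq_same]
      linarith
    · simp [hoff t ht, ht]
  have hLd : ∀ x y, Ld x y = inner ℝ (v x) (v y) := by
    intro x y
    rw [← hV, Matrix.mul_apply, PiLp.inner_apply]
    refine sum_congr rfl fun j _ => ?_
    simp [hv, mul_comm]
  have hLdpi : ∀ x, (Ld *ᵥ pi) x = inner ℝ (v x) ℓ := by
    intro x
    simp only [hl, inner_sum, inner_smul_right, mulVec, dotProduct, hLd, mul_comm]
  have hhit : ∀ y, h y x =
      inner ℝ (v x) ℓ - inner ℝ (v x) (v y) - inner ℝ (v y) ℓ + ‖v y‖ ^ 2 := by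
    intro y
    have hconst := hker (Ld *ᵥ (L *ᵥ h y) - h y) (by
      rw [mulVec_sub, mulVec_mulVec, mulVec_mulVec, hp1, sub_self]) x y
    rw [hLh, mulVec_sub, mulVec_single_one] at hconst
    simp only [Pi.sub_apply, hLdpi, col_apply, hLd, hdiag, real_inner_self_eq_norm_sq] at hconst
    linarith
  have havg : ∀ u : EuclideanSpace ℝ (Fin (n-1)),
      ∑ y, pi y * inner ℝ u (v y) = inner ℝ u ℓ := by
    intro u
    simp only [hl, inner_sum, inner_smul_right]
  have hK : ∑ y, pi y * h y x = ∑ y, pi y * ‖v y‖ ^ 2 - ‖ℓ‖ ^ 2 := by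
    have h1 : ∑ y, pi y * h y x = (∑ y, pi y) * inner ℝ (v x) ℓ
        - ∑ y, pi y * inner ℝ (v x) (v y) - ∑ y, pi y * inner ℝ ℓ (v y)
        + ∑ y, pi y * ‖v y‖ ^ 2 := by
      rw [sum_mul, ← sum_sub_distrib, ← sum_sub_distrib, ← sum_add_distrib]
      refine sum_congr rfl fun y _ => ?_
      rw [hhit, real_inner_comm (v y) ℓ]
      ring
    rw [h1, havg, havg, hpisum, real_inner_self_eq_norm_sq]
    ring
  have hR2 := sum_mul_norm_sub_sq pi hpisum v γ
  simp only [hcirc, ← sum_mul, hpisum, one_mul, ← hl] at hR2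
  rw [hK]
  linarith
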